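/- arXiv:1406.4895 — 5 statements merged into one kernel-verified Lean document; each statement's English description precedes it below -/
import Mathlib

section
/- Let P ⊆ ℝ^p be a polytope whose affine hull has dimension d ≥ 1. Then xc(P) = d + 2 if and only if min{f(P), v(P)} = d + 2, where f(P) is the number of facets of P (the smallest number of inequalities in any outer description of P with linear equations not counted) and v(P) is the number of vertices (extreme points) of P. -/
/-- `P` admits an extended formulation with `m` inequalities (and finitely many
linear equations): a feasible region in some `ℝ^q` projecting linearly onto `P`. -/
def IsExtFormulation {p : ℕ} (P : Set (Fin p → ℝ)) (m : ℕ) : Prop :=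
  ∃ (q s : ℕ) (A : Matrix (Fin m) (Fin q) ℝ) (b : Fin m → ℝ)
    (C : Matrix (Fin s) (Fin q) ℝ) (d : Fin s → ℝ)
    (π : (Fin q → ℝ) →ₗ[ℝ] (Fin p → ℝ)),
    π '' {y | A.mulVec y ≤ b ∧ C.mulVec y = d} = P

/-- The extension complexity of `P`: the smallest number of inequalities in any
extended formulation for `P`. -/
noncomputable def xc {p : ℕ} (P : Set (Fin p → ℝ)) : ℕ :=
  sInf {m | IsExtFormulation P m}

/-- A polytope is the convex hull of a finite set of points. -/
def IsPolytope {p : ℕ} (P : Set (Fin p → ℝ)) : Prop :=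
  ∃ V : Finset (Fin p → ℝ), P = convexHull ℝ (V : Set (Fin p → ℝ))

/-- The number of facets of a polytope `P ⊆ ℝ^p`: the smallest number of
inequalities in any outer description of `P` (linear equations not counted). -/
noncomputable def numFacets {p : ℕ} (P : Set (Fin p → ℝ)) : ℕ :=
  sInf {m | ∃ (s : ℕ) (A : Matrix (Fin m) (Fin p) ℝ) (b : Fin m → ℝ)
    (C : Matrix (Fin s) (Fin p) ℝ) (d : Fin s → ℝ),
    P = {x | A.mulVec x ≤ b ∧ C.mulVec x = d}}

/-- The number of vertices (extreme points) of `P`. -/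
noncomputable def numVertices {p : ℕ} (P : Set (Fin p → ℝ)) : ℕ :=
  Nat.card (Set.extremePoints ℝ P)

/-- `P` is described by `m` inequalities and finitely many linear equations. -/
def HasFacetDescription {p : ℕ} (P : Set (Fin p → ℝ)) (m : ℕ) : Prop :=
  ∃ (s : ℕ) (A : Matrix (Fin m) (Fin p) ℝ) (b : Fin m → ℝ)
    (C : Matrix (Fin s) (Fin p) ℝ) (d : Fin s → ℝ),
    P = {x | A.mulVec x ≤ b ∧ C.mulVec x = d}

theorem numFacets_le {p m : ℕ} {P : Set (Fin p → ℝ)} (h : HasFacetDescription P m) :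
    numFacets P ≤ m :=
  Nat.sInf_le h

theorem xc_le {p m : ℕ} {P : Set (Fin p → ℝ)} (h : IsExtFormulation P m) : xc P ≤ m :=
  Nat.sInf_le h

/-- A feasible region given by linear maps into arbitrary finite coordinate spaces is given by
matrices with `Fin` indices. -/
theorem exists_matrix_description {q : ℕ} {ι κ : Type*} [Fintype ι] [Fintype κ]
    (A : (Fin q → ℝ) →ₗ[ℝ] (ι → ℝ)) (b : ι → ℝ) (C : (Fin q → ℝ) →ₗ[ℝ] (κ → ℝ)) (d : κ → ℝ) :
    HasFacetDescription {y | A y ≤ b ∧ C y = d} (Fintype.card ι) := by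
  let e := Fintype.equivFin ι
  let e' := Fintype.equivFin κ
  refine ⟨Fintype.card κ, (LinearMap.toMatrix' A).submatrix e.symm id, b ∘ e.symm,
    (LinearMap.toMatrix' C).submatrix e'.symm id, d ∘ e'.symm, ?_⟩
  have hA (y : Fin q → ℝ) :
      ((LinearMap.toMatrix' A).submatrix e.symm id).mulVec y = A y ∘ e.symm := by
    rw [← LinearMap.toMatrix'_mulVec A y]; rfl
  have hC (y : Fin q → ℝ) :
      ((LinearMap.toMatrix' C).submatrix e'.symm id).mulVec y = C y ∘ e'.symm := by
    rw [← LinearMap.toMatrix'_mulVec C y]; rfl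
  ext y
  simp only [Set.mem_ofPred_eq, hA, hC]
  refine and_congr ?_ ?_
  · exact ⟨fun h i => h _, fun h i => by simpa using h (e i)⟩
  · exact (e'.symm.surjective.injective_comp_right.eq_iff).symm

theorem isExtFormulation_of_facetDescription {p q m : ℕ} {Q : Set (Fin q → ℝ)}
    (h : HasFacetDescription Q m) (π : (Fin q → ℝ) →ₗ[ℝ] (Fin p → ℝ)) :
    IsExtFormulation (π '' Q) m := by
  obtain ⟨s, A, b, C, d, rfl⟩ := h
  exact ⟨q, s, A, b, C, d, π, rfl⟩

theorem xc_le_of_facetDescription {p m : ℕ} {P : Set (Fin p → ℝ)}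
    (h : HasFacetDescription P m) : xc P ≤ m :=
  xc_le (by simpa using isExtFormulation_of_facetDescription h LinearMap.id)

section Cone

variable {E : Type*} [AddCommGroup E] [Module ℝ E]

/-- The convex hull of a finite family is a linear image of the standard simplex. -/
theorem convexHull_range_eq_image_stdSimplex {ι : Type*} [Fintype ι] (v : ι → E) :
    convexHull ℝ (Set.range v) = Fintype.linearCombination ℝ v '' stdSimplex ℝ ι := by
  classical
  rw [← convexHull_rangle_single_eq_stdSimplex, LinearMap.image_convexHull, ← Set.range_comp]
  congr 2
  ext i
  simp [Fintype.linearCombination_apply_single]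

/-- Elimination of one nonnegative variable from a finite system of homogeneous linear
inequalities. -/
theorem exists_eliminated_inequalities (F : Finset (Module.Dual ℝ E)) (u : E) :
    ∃ G : Finset (Module.Dual ℝ E), ∀ z : E,
      (∃ t : ℝ, 0 ≤ t ∧ ∀ f ∈ F, f (z - t • u) ≤ 0) ↔ ∀ g ∈ G, g z ≤ 0 := by
  classical
  refine ⟨F.filter (fun f => f u ≤ 0) ∪
    ((F.filter (fun f => 0 < f u)) ×ˢ (F.filter (fun f => f u < 0))).image
      (fun r => (-(r.2 u)) • r.1 + (r.1 u) • r.2), fun z => ⟨?_, fun h => ?_⟩⟩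
  · rintro ⟨t, ht, hF⟩ g hg
    simp only [map_sub, map_smul, smul_eq_mul] at hF
    rcases Finset.mem_union.1 hg with hg | hg
    · obtain ⟨hg, hgu⟩ := Finset.mem_filter.1 hg
      nlinarith [hF g hg]
    · obtain ⟨⟨f, f'⟩, hff, rfl⟩ := Finset.mem_image.1 hg
      simp only [Finset.mem_product, Finset.mem_filter] at hff
      obtain ⟨⟨hf, hfu⟩, hf', hfu'⟩ := hff
      simp only [LinearMap.add_apply, LinearMap.smul_apply, smul_eq_mul]
      nlinarith [mul_le_mul_of_nonneg_left (hF f hf) (neg_nonneg.2 hfu'.le),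
        mul_le_mul_of_nonneg_left (hF f' hf') hfu.le]
  · have h0 : ∀ f ∈ F, f u ≤ 0 → f z ≤ 0 := fun f hf hfu =>
      h f (Finset.mem_union_left _ (Finset.mem_filter.2 ⟨hf, hfu⟩))
    have h1 : ∀ f ∈ F, ∀ f' ∈ F, 0 < f u → f' u < 0 → -(f' u) * f z + f u * f' z ≤ 0 := by
      intro f hf f' hf' hfu hfu'
      have := h _ (Finset.mem_union_right _ (Finset.mem_image_of_mem _
        (Finset.mk_mem_product (Finset.mem_filter.2 ⟨hf, hfu⟩)
          (Finset.mem_filter.2 ⟨hf', hfu'⟩))))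
      simpa using this
    let L : Finset ℝ := insert 0 ((F.filter (fun f => 0 < f u)).image (fun f => f z / f u))
    have hL : L.Nonempty := Finset.insert_nonempty _ _
    refine ⟨L.max' hL, L.le_max' 0 (Finset.mem_insert_self _ _), fun f hf => ?_⟩
    simp only [map_sub, map_smul, smul_eq_mul, sub_nonpos]
    rcases lt_or_ge 0 (f u) with hfu | hfu
    · rw [← div_le_iff₀ hfu]
      exact L.le_max' _ (Finset.mem_insert_of_mem
        (Finset.mem_image_of_mem _ (Finset.mem_filter.2 ⟨hf, hfu⟩)))
    · rcases Finset.mem_insert.1 (L.max'_mem hL) with hm | hm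
      · rw [hm, zero_mul]; exact h0 f hf hfu
      · obtain ⟨k, hk, hkm⟩ := Finset.mem_image.1 hm
        obtain ⟨hk, hku⟩ := Finset.mem_filter.1 hk
        rw [← hkm]
        rcases hfu.lt_or_eq with hfu | hfu
        · have := h1 k hk f hf hku hfu
          rw [div_mul_eq_mul_div, le_div_iff₀ hku]
          linarith
        · rw [hfu, mul_zero]; exact h0 f hf hfu.le

/-- A finitely generated cone is the solution set of finitely many homogeneous linear
inequalities. -/
theorem exists_inequalities_of_cone [FiniteDimensional ℝ E] (n : ℕ) (u : Fin n → E) :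
    ∃ F : Finset (Module.Dual ℝ E), ∀ z : E,
      (∃ w : Fin n → ℝ, (∀ i, 0 ≤ w i) ∧ ∑ i, w i • u i = z) ↔ ∀ f ∈ F, f z ≤ 0 := by
  classical
  induction n with
  | zero =>
    let B := Module.finBasis ℝ E
    refine ⟨Finset.univ.image (fun i => B.coord i) ∪ Finset.univ.image (fun i => -B.coord i),
      fun z => ⟨?_, fun h => ?_⟩⟩
    · rintro ⟨w, -, rfl⟩ f -
      simp
    · have hz : z = 0 := by
        rw [← B.forall_coord_eq_zero_iff]
        intro i
        have h1 := h (B.coord i) (by simp)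
        have h2 := h (-B.coord i) (by simp)
        rw [LinearMap.neg_apply] at h2
        linarith
      exact ⟨0, by simp, by simp [hz]⟩
  | succ n ih =>
    obtain ⟨F, hF⟩ := ih (Fin.tail u)
    obtain ⟨G, hG⟩ := exists_eliminated_inequalities F (u 0)
    refine ⟨G, fun z => ?_⟩
    rw [← hG, Fin.exists_fin_succ_pi]
    refine exists_congr fun t => ?_
    rw [← hF, ← exists_and_left]
    refine exists_congr fun w => ?_
    simp only [Fin.forall_fin_succ, Fin.cons_zero, Fin.cons_succ, Fin.sum_univ_succ, and_assoc,
      Fin.tail, eq_sub_iff_add_eq']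

end Cone

theorem exists_facetDescription {p : ℕ} {P : Set (Fin p → ℝ)} (hP : IsPolytope P) :
    ∃ m, HasFacetDescription P m := by
  obtain ⟨V, rfl⟩ := hP
  let v : Fin V.card → (Fin p → ℝ) := fun i => (V.equivFin.symm i : Fin p → ℝ)
  have hv : (V : Set (Fin p → ℝ)) = Set.range v := by
    have : v = Subtype.val ∘ V.equivFin.symm := rfl
    rw [this, V.equivFin.symm.surjective.range_comp]
    simp
  obtain ⟨F, hF⟩ := exists_inequalities_of_cone V.card (fun i => (v i, (1 : ℝ)))
  refine ⟨Fintype.card F, ?_⟩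
  convert exists_matrix_description (ι := F) (κ := Fin 0)
    (LinearMap.pi fun f => (f : Module.Dual ℝ ((Fin p → ℝ) × ℝ)) ∘ₗ LinearMap.inl ℝ _ _)
    (fun f => -(f : Module.Dual ℝ ((Fin p → ℝ) × ℝ)) (0, 1)) 0 0 using 1
  ext x
  have hx : (x, (1 : ℝ)) = (x, 0) + (0, 1) := by simp
  have : (∀ f ∈ F, f (x, (1 : ℝ)) ≤ 0) ↔ ∀ f ∈ F, f (x, 0) ≤ -f (0, 1) := by
    simp only [hx, map_add, le_neg_iff_add_nonpos_right]
  rw [hv, convexHull_range_eq_image_stdSimplex]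
  simp only [Set.mem_image, Set.mem_ofPred_eq, Pi.le_def, LinearMap.pi_apply, LinearMap.comp_apply,
    LinearMap.inl_apply, Subtype.forall, LinearMap.zero_apply, and_true]
  rw [← this, ← hF]
  refine exists_congr fun w => ?_
  simp [stdSimplex, Fintype.linearCombination_apply, Prod.ext_iff, Prod.fst_sum, Prod.snd_sum,
    and_assoc, and_comm, and_left_comm]

theorem IsPolytope.finite_extremePoints {p : ℕ} {P : Set (Fin p → ℝ)} (hP : IsPolytope P) :
    (P.extremePoints ℝ).Finite := by
  obtain ⟨V, rfl⟩ := hP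
  exact V.finite_toSet.subset (extremePoints_convexHull_subset (𝕜 := ℝ))

theorem IsPolytope.isCompact {p : ℕ} {P : Set (Fin p → ℝ)} (hP : IsPolytope P) :
    IsCompact P := by
  obtain ⟨V, rfl⟩ := hP
  exact V.finite_toSet.isCompact_convexHull ℝ

theorem IsPolytope.convexHull_extremePoints {p : ℕ} {P : Set (Fin p → ℝ)} (hP : IsPolytope P) :
    convexHull ℝ (P.extremePoints ℝ) = P := by
  have hconv : Convex ℝ P := by
    obtain ⟨V, rfl⟩ := hP
    exact convex_convexHull ℝ _
  rw [← (hP.finite_extremePoints.isClosed_convexHull ℝ).closure_eq]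
  exact closure_convexHull_extremePoints hP.isCompact hconv

theorem IsPolytope.xc_le_numVertices {p : ℕ} {P : Set (Fin p → ℝ)} (hP : IsPolytope P) :
    xc P ≤ numVertices P := by
  have := hP.finite_extremePoints.fintype
  let e := Fintype.equivFin (P.extremePoints ℝ)
  let v : Fin (Fintype.card (P.extremePoints ℝ)) → (Fin p → ℝ) := fun i => (e.symm i : Fin p → ℝ)
  have hv : Set.range v = P.extremePoints ℝ := by
    have : v = Subtype.val ∘ e.symm := rfl
    rw [this, e.symm.surjective.range_comp, Subtype.range_coe]
  have hP' : P = Fintype.linearCombination ℝ v '' stdSimplex ℝ _ := by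
    rw [← convexHull_range_eq_image_stdSimplex, hv, hP.convexHull_extremePoints]
  have hS : HasFacetDescription (stdSimplex ℝ (Fin (Fintype.card (P.extremePoints ℝ))))
      (Fintype.card (Fin (Fintype.card (P.extremePoints ℝ)))) := by
    convert exists_matrix_description (-LinearMap.id) 0
      (LinearMap.pi fun _ : Fin 1 => ∑ i, LinearMap.proj i) (fun _ => (1 : ℝ)) using 1
    ext w
    simp [stdSimplex, Pi.le_def, funext_iff]
  rw [numVertices, Nat.card_eq_fintype_card]
  rw [Fintype.card_fin] at hS
  conv_lhs => rw [hP']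
  exact xc_le (isExtFormulation_of_facetDescription hS _)

theorem numVertices_le_of_eq_convexHull {p m : ℕ} {P : Set (Fin p → ℝ)} (v : Fin m → Fin p → ℝ)
    (h : P = convexHull ℝ (Set.range v)) : numVertices P ≤ m := by
  subst h
  calc numVertices _ ≤ Nat.card (Set.range v) :=
        Nat.card_mono (Set.finite_range v) extremePoints_convexHull_subset
    _ ≤ Nat.card (Fin m) := Finite.card_range_le v
    _ = m := Nat.card_fin m

section Projection

variable {E : Type*} [AddCommGroup E] [Module ℝ E] {p m : ℕ}
  {A : E →ₗ[ℝ] (Fin m → ℝ)} {b : Fin m → ℝ} {K : Submodule ℝ E} {y₀ : E}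
  {π : E →ₗ[ℝ] (Fin p → ℝ)} {P : Set (Fin p → ℝ)}

theorem direction_le_map (hP : π '' {y | A y ≤ b ∧ y - y₀ ∈ K} = P) :
    (affineSpan ℝ P).direction ≤ K.map π := by
  rw [direction_affineSpan, vectorSpan_def, Submodule.span_le]
  rintro _ ⟨x, hx, x', hx', rfl⟩
  rw [← hP] at hx hx'
  obtain ⟨y, hy, rfl⟩ := hx
  obtain ⟨y', hy', rfl⟩ := hx'
  refine ⟨y - y', ?_, by simp⟩
  simpa using K.sub_mem hy.2 hy'.2

theorem ker_domRestrict_le (hK : ∀ r ∈ K, A r ≤ 0 → A r = 0 ∧ π r = 0) :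
    LinearMap.ker (A.domRestrict K) ≤ LinearMap.ker (π.domRestrict K) := by
  rintro ⟨r, hr⟩ h
  exact (hK r hr (le_of_eq h)).2

theorem finrank_map_le_finrank_map [FiniteDimensional ℝ E]
    (hK : ∀ r ∈ K, A r ≤ 0 → A r = 0 ∧ π r = 0) :
    Module.finrank ℝ (K.map π) ≤ Module.finrank ℝ (K.map A) := by
  rw [← LinearMap.range_domRestrict, ← LinearMap.range_domRestrict]
  have h1 := (A.domRestrict K).finrank_range_add_finrank_ker
  have h2 := (π.domRestrict K).finrank_range_add_finrank_ker
  have h3 := Submodule.finrank_mono (ker_domRestrict_le hK)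
  omega

theorem finrank_direction_le [FiniteDimensional ℝ E]
    (hK : ∀ r ∈ K, A r ≤ 0 → A r = 0 ∧ π r = 0)
    (hP : π '' {y | A y ≤ b ∧ y - y₀ ∈ K} = P) :
    Module.finrank ℝ (affineSpan ℝ P).direction ≤ Module.finrank ℝ (K.map A) :=
  (Submodule.finrank_mono (direction_le_map hP)).trans (finrank_map_le_finrank_map hK)

theorem finrank_map_lt (hK : ∀ r ∈ K, A r ≤ 0 → A r = 0 ∧ π r = 0) (hm : 0 < m) :
    Module.finrank ℝ (K.map A) < m := by
  have h : K.map A ≠ ⊤ := by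
    intro h
    obtain ⟨r, hr, hAr⟩ : (-1 : Fin m → ℝ) ∈ K.map A := h ▸ Submodule.mem_top
    have := (hK r hr (by rw [hAr]; simp)).1
    rw [hAr] at this
    simpa using congrFun this ⟨0, hm⟩
  simpa using Submodule.finrank_lt h

theorem facetDescription_of_finrank_map_le [FiniteDimensional ℝ E]
    (hK : ∀ r ∈ K, A r ≤ 0 → A r = 0 ∧ π r = 0)
    (hP : π '' {y | A y ≤ b ∧ y - y₀ ∈ K} = P)
    (hrank : Module.finrank ℝ (K.map A) ≤ Module.finrank ℝ (affineSpan ℝ P).direction) :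
    HasFacetDescription P m := by
  have hker : LinearMap.ker (A.domRestrict K) = LinearMap.ker (π.domRestrict K) := by
    refine Submodule.eq_of_le_of_finrank_le (ker_domRestrict_le hK) ?_
    have h1 := (A.domRestrict K).finrank_range_add_finrank_ker
    have h2 := (π.domRestrict K).finrank_range_add_finrank_ker
    have h3 := Submodule.finrank_mono (direction_le_map hP)
    rw [LinearMap.range_domRestrict] at h1 h2
    omega
  obtain ⟨s, hs⟩ := (π.domRestrict K).rangeRestrict.exists_rightInverse_of_surjective
    (LinearMap.range_rangeRestrict _)
  obtain ⟨g, hg⟩ := (A.domRestrict K ∘ₗ s).exists_extend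
  have hgπ (r : E) (hr : r ∈ K) : g (π r) = A r := by
    let x : LinearMap.range (π.domRestrict K) := (π.domRestrict K).rangeRestrict ⟨r, hr⟩
    have h1 : g (π r) = A.domRestrict K (s x) := DFunLike.congr_fun hg x
    have h2 : (π.domRestrict K) (s x) = π r := congrArg Subtype.val (DFunLike.congr_fun hs x)
    have h3 : s x - ⟨r, hr⟩ ∈ LinearMap.ker (A.domRestrict K) := by
      rw [hker, LinearMap.mem_ker, map_sub, h2]
      simp
    rw [LinearMap.mem_ker, map_sub, sub_eq_zero] at h3
    rw [h1, h3]
    simp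
  obtain ⟨U, hU⟩ := (K.map π).exists_isCompl
  obtain ⟨c, hc⟩ : ∃ c : (Fin p → ℝ) →ₗ[ℝ] (Fin p → ℝ), LinearMap.ker c = K.map π :=
    ⟨U.projection (K.map π) hU.symm, by simp⟩
  convert exists_matrix_description g (b - A y₀ + g (π y₀)) c (c (π y₀)) using 1
  · rw [← hP]
    ext x
    constructor
    · rintro ⟨y, ⟨hy, hyK⟩, rfl⟩
      have h1 := hgπ _ hyK
      have h2 : π (y - y₀) ∈ LinearMap.ker c := hc ▸ Submodule.mem_map_of_mem hyK
      rw [LinearMap.mem_ker, map_sub, map_sub, sub_eq_zero] at h2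
      refine ⟨fun i => ?_, h2⟩
      have h3 := congrFun h1 i
      have h4 := hy i
      simp only [map_sub, Pi.sub_apply, Pi.add_apply] at h3 ⊢
      linarith
    · rintro ⟨hx, hcx⟩
      have h1 : x - π y₀ ∈ K.map π := by
        rw [← hc, LinearMap.mem_ker, map_sub, hcx, sub_self]
      obtain ⟨r, hr, hrx⟩ := h1
      refine ⟨y₀ + r, ⟨fun i => ?_, by simpa using hr⟩, by rw [map_add, hrx]; abel⟩
      have h3 := congrFun (hgπ r hr) i
      have h4 := hx i
      rw [hrx] at h3
      simp only [map_sub, map_add, Pi.sub_apply, Pi.add_apply] at h3 h4 ⊢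
      linarith
  · simp

/-- A hyperplane meeting the nonpositive orthant only in the origin has a normal vector with
positive entries. -/
theorem exists_pos_normal {W : Submodule ℝ (Fin m → ℝ)} (hW : ∀ w ∈ W, w ≤ 0 → w = 0)
    (hrank : Module.finrank ℝ W + 1 = m) :
    ∃ c : Fin m → ℝ, (∀ i, 0 < c i) ∧ ∀ w, w ∈ W ↔ ∑ i, c i * w i = 0 := by
  classical
  have hlt : W < ⊤ := by
    refine lt_top_iff_ne_top.2 fun h => ?_
    rw [h] at hrank
    simp at hrank
  obtain ⟨φ, hφ, hle⟩ := W.exists_le_ker_of_lt_top hlt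
  have hker : W = LinearMap.ker φ := by
    refine Submodule.eq_of_le_of_finrank_le hle ?_
    have h1 := Module.Dual.finrank_ker_add_one_of_ne_zero hφ
    simp only [Module.finrank_fin_fun] at h1
    omega
  have hφ_apply (w : Fin m → ℝ) : φ w = ∑ i, φ (Pi.single i 1) * w i := by
    rw [LinearMap.pi_apply_eq_sum_univ φ w]
    refine Finset.sum_congr rfl fun i _ => ?_
    rw [smul_eq_mul, mul_comm]
    congr 2
    ext j
    simp [Pi.single_apply, eq_comm]
  have hpos (i j : Fin m) : 0 < φ (Pi.single i 1) * φ (Pi.single j 1) := by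
    by_contra! hij
    have hne (k : Fin m) : φ (Pi.single k 1) ≠ 0 := by
      intro hk
      have h1 : -Pi.single k (1 : ℝ) ∈ W := by rw [hker, LinearMap.mem_ker, map_neg, hk, neg_zero]
      have h2 := hW _ h1 (by simp)
      simpa using congrFun h2 k
    have hlt : φ (Pi.single i 1) * φ (Pi.single j 1) < 0 :=
      lt_of_le_of_ne hij (mul_ne_zero (hne i) (hne j))
    let w : Fin m → ℝ := (φ (Pi.single i 1) * φ (Pi.single j 1)) • Pi.single i 1
      - (φ (Pi.single i 1) ^ 2) • Pi.single j 1
    have h1 : w ∈ W := by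
      rw [hker, LinearMap.mem_ker]
      simp only [w, map_sub, map_smul, smul_eq_mul]
      ring
    have h2 : w ≤ 0 := by
      intro k
      simp only [w, Pi.sub_apply, Pi.smul_apply, smul_eq_mul, Pi.zero_apply]
      have h3 : 0 ≤ (Pi.single i 1 : Fin m → ℝ) k := by
        rw [Pi.single_apply]; split_ifs <;> norm_num
      have h4 : 0 ≤ (Pi.single j 1 : Fin m → ℝ) k := by
        rw [Pi.single_apply]; split_ifs <;> norm_num
      nlinarith [mul_nonneg (sq_nonneg (φ (Pi.single i 1))) h4]
    have hij' : i ≠ j := by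
      rintro rfl
      nlinarith [sq_nonneg (φ (Pi.single i 1))]
    have h5 := congrFun (hW w h1 h2) i
    simp [w, hij', hne] at h5
  have hm : 0 < m := by omega
  refine ⟨fun i => φ (Pi.single ⟨0, hm⟩ 1) * φ (Pi.single i 1), fun i => hpos _ i, fun w => ?_⟩
  have hne : φ (Pi.single ⟨0, hm⟩ 1) ≠ 0 := fun h => by simpa [h] using hpos ⟨0, hm⟩ ⟨0, hm⟩
  simp only [mul_assoc]
  rw [← Finset.mul_sum, ← hφ_apply, mul_eq_zero, or_iff_right hne, hker, LinearMap.mem_ker]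

theorem numVertices_le_of_finrank_map (hK : ∀ r ∈ K, A r ≤ 0 → A r = 0 ∧ π r = 0)
    (hP : π '' {y | A y ≤ b ∧ y - y₀ ∈ K} = P) (hy₀ : A y₀ ≤ b)
    (hrank : Module.finrank ℝ (K.map A) + 1 = m) : numVertices P ≤ m := by
  classical
  obtain ⟨c, hc, hcW⟩ := exists_pos_normal (W := K.map A)
    (by rintro _ ⟨r, hr, rfl⟩ h; exact (hK r hr h).1) hrank
  let γ : ℝ := ∑ i, c i * (b i - A y₀ i)
  have hγ : 0 ≤ γ := Finset.sum_nonneg fun i _ => mul_nonneg (hc i).le (sub_nonneg.2 (hy₀ i))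
  have hvert (i : Fin m) : ∃ y, y - y₀ ∈ K ∧ A y = b - Pi.single i (γ / c i) := by
    have : b - Pi.single i (γ / c i) - A y₀ ∈ K.map A := by
      rw [hcW]
      have h1 (j : Fin m) : c j * (b - Pi.single i (γ / c i) - A y₀ : Fin m → ℝ) j
          = c j * (b j - A y₀ j) - c j * (Pi.single i (γ / c i) : Fin m → ℝ) j := by
        simp only [Pi.sub_apply]; ring
      simp only [h1, Finset.sum_sub_distrib]
      simp [Pi.single_apply, mul_div_cancel₀ _ (hc i).ne', γ]
    obtain ⟨r, hr, hAr⟩ := this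
    exact ⟨y₀ + r, by simpa using hr, by rw [map_add, hAr]; abel⟩
  choose y hyK hAy using hvert
  have heq {z z' : E} (hz : z - y₀ ∈ K) (hz' : z' - y₀ ∈ K) (h : A z = A z') : π z = π z' := by
    have h1 : z - z' ∈ K := by simpa using K.sub_mem hz hz'
    have h2 := (hK _ h1 (by rw [map_sub, h, sub_self])).2
    rwa [map_sub, sub_eq_zero] at h2
  refine numVertices_le_of_eq_convexHull (fun i => π (y i)) (hP.symm.trans (Set.Subset.antisymm ?_ ?_))
  · rintro _ ⟨z, ⟨hz, hzK⟩, rfl⟩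
    have hsum : ∑ i, c i * (b i - A z i) = γ := by
      have h1 := (hcW _).1 (Submodule.mem_map_of_mem (f := A) hzK)
      rw [← sub_eq_zero, ← neg_eq_zero, ← h1]
      simp only [γ, ← Finset.sum_sub_distrib, ← Finset.sum_neg_distrib, map_sub, Pi.sub_apply]
      exact Finset.sum_congr rfl fun i _ => by ring
    have hterm (i : Fin m) : 0 ≤ c i * (b i - A z i) :=
      mul_nonneg (hc i).le (sub_nonneg.2 (hz i))
    rcases hγ.eq_or_lt with hγ0 | hγ0
    · have hm : 0 < m := by omega
      refine subset_convexHull ℝ _ ⟨⟨0, hm⟩, heq (hyK _) hzK ?_⟩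
      rw [hAy]
      ext i
      rw [← hγ0, Finset.sum_eq_zero_iff_of_nonneg fun i _ => hterm i] at hsum
      have h1 := hsum i (Finset.mem_univ i)
      rw [mul_eq_zero, or_iff_right (hc i).ne'] at h1
      simp only [← hγ0, zero_div, Pi.single_zero, sub_zero]
      linarith
    · rw [convexHull_range_eq_image_stdSimplex]
      have hw : ∑ i, c i * (b i - A z i) / γ = 1 := by
        rw [← Finset.sum_div, hsum, div_self hγ0.ne']
      refine ⟨fun i => c i * (b i - A z i) / γ, ⟨fun i => div_nonneg (hterm i) hγ, hw⟩, ?_⟩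
      simp only [Fintype.linearCombination_apply, ← map_smul, ← map_sum]
      refine heq ?_ hzK ?_
      · have h1 : ∑ i, (c i * (b i - A z i) / γ) • y i - y₀
            = ∑ i, (c i * (b i - A z i) / γ) • (y i - y₀) := by
          simp only [smul_sub, Finset.sum_sub_distrib, ← Finset.sum_smul, hw, one_smul]
        rw [h1]
        exact K.sum_mem fun i _ => K.smul_mem _ (hyK i)
      · simp only [map_sum, map_smul, hAy, smul_sub, Finset.sum_sub_distrib, ← Finset.sum_smul, hw,
          one_smul]
        ext j
        have h2 : c j * (b j - A z j) / γ * (γ / c j) = b j - A z j := by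
          have := (hc j).ne'
          field_simp
        simp [Finset.sum_apply, Pi.single_apply, h2]
  · refine convexHull_min ?_ ?_
    · rintro _ ⟨i, rfl⟩
      refine ⟨y i, ⟨?_, hyK i⟩, rfl⟩
      rw [hAy]
      exact sub_le_self _ (Pi.single_nonneg.2 (div_nonneg hγ (hc i).le))
    · have hconv : Convex ℝ {y | A y ≤ b ∧ y - y₀ ∈ K} := by
        intro u hu v hv s t hs ht hst
        refine ⟨?_, ?_⟩
        · rw [map_add, map_smul, map_smul]
          calc s • A u + t • A v ≤ s • b + t • b :=
                add_le_add (smul_le_smul_of_nonneg_left hu.1 hs)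
                  (smul_le_smul_of_nonneg_left hv.1 ht)
            _ = b := by rw [← add_smul, hst, one_smul]
        · have h1 : s • u + t • v - y₀ = s • (u - y₀) + t • (v - y₀) := by
            have : y₀ = (s + t) • y₀ := by rw [hst, one_smul]
            conv_lhs => rw [this]
            module
          rw [h1]
          exact K.add_mem (K.smul_mem _ hu.2) (K.smul_mem _ hv.2)
      exact hconv.linear_image π

end Projection

/-- In an extended formulation of minimum size of a bounded set, every recession direction is a
lineality direction, and it is annihilated by the projection. -/
theorem recession_eq_zero_of_minimal {p q s m : ℕ} {P : Set (Fin p → ℝ)}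
    (hbdd : Bornology.IsBounded P) {A : Matrix (Fin m) (Fin q) ℝ} {b : Fin m → ℝ}
    {C : Matrix (Fin s) (Fin q) ℝ} {d : Fin s → ℝ} {π : (Fin q → ℝ) →ₗ[ℝ] (Fin p → ℝ)}
    (hP : π '' {y | A.mulVec y ≤ b ∧ C.mulVec y = d} = P) (hne : P.Nonempty)
    (hmin : ∀ n, IsExtFormulation P n → m ≤ n) {r : Fin q → ℝ} (hC : C.mulVec r = 0)
    (hA : A.mulVec r ≤ 0) : A.mulVec r = 0 ∧ π r = 0 := by
  classical
  have hπ : π r = 0 := by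
    obtain ⟨x, hx⟩ := hne
    rw [← hP] at hx
    obtain ⟨y, ⟨hyA, hyC⟩, rfl⟩ := hx
    obtain ⟨R, hR⟩ := hbdd.exists_norm_le
    have hray (t : ℝ) (ht : 0 ≤ t) : ‖π y + t • π r‖ ≤ R := by
      refine hR _ (hP ▸ ⟨y + t • r, ⟨?_, ?_⟩, by simp⟩)
      · rw [Matrix.mulVec_add, Matrix.mulVec_smul]
        exact (add_le_of_nonpos_right (smul_nonpos_of_nonneg_of_nonpos ht hA)).trans hyA
      · rw [Matrix.mulVec_add, Matrix.mulVec_smul, hC, smul_zero, add_zero, hyC]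
    by_contra hr
    have hr : 0 < ‖π r‖ := norm_pos_iff.2 hr
    have hR0 : 0 ≤ R := (norm_nonneg _).trans (hray 0 le_rfl)
    have hy := hray 0 le_rfl
    rw [zero_smul, add_zero] at hy
    have h1 : 0 ≤ (2 * R + 1) / ‖π r‖ := by positivity
    have h2 := hray _ h1
    have h3 : ‖((2 * R + 1) / ‖π r‖) • π r‖ = 2 * R + 1 := by
      rw [norm_smul, Real.norm_of_nonneg h1, div_mul_cancel₀ _ hr.ne']
    have h4 := norm_sub_le (π y + ((2 * R + 1) / ‖π r‖) • π r) (π y)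
    rw [add_sub_cancel_left, h3] at h4
    linarith
  refine ⟨?_, hπ⟩
  by_contra hne0
  obtain ⟨i, hi⟩ := Function.ne_iff.1 hne0
  have hcard : Fintype.card {j // A.mulVec r j = 0} < m := by
    simpa using Fintype.card_subtype_lt (p := fun j => A.mulVec r j = 0) hi
  refine absurd (hmin (Fintype.card {j // A.mulVec r j = 0}) ?_) (not_le.2 hcard)
  have hQ := exists_matrix_description
    (LinearMap.funLeft ℝ ℝ (Subtype.val : {j // A.mulVec r j = 0} → Fin m) ∘ₗ A.mulVecLin)
    (b ∘ Subtype.val) C.mulVecLin d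
  convert isExtFormulation_of_facetDescription hQ π using 1
  rw [← hP]
  refine Set.Subset.antisymm (Set.image_mono fun y hy => ⟨fun j => hy.1 j, hy.2⟩) ?_
  rintro _ ⟨y, ⟨hyA, hyC⟩, rfl⟩
  have hyA' (j : Fin m) (hj : A.mulVec r j = 0) : A.mulVec y j ≤ b j := hyA ⟨j, hj⟩
  have hyC' : C.mulVec y = d := hyC
  let τ (j : Fin m) : ℝ := |A.mulVec y j - b j| / |A.mulVec r j|
  let t : ℝ := ∑ j, τ j
  have hτ (j : Fin m) : 0 ≤ τ j := by positivity
  refine ⟨y + t • r, ⟨fun j => ?_, ?_⟩, by simp [hπ]⟩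
  · rw [Matrix.mulVec_add, Matrix.mulVec_smul, Pi.add_apply, Pi.smul_apply, smul_eq_mul]
    rcases (hA j).eq_or_lt with hj | hj
    · rw [hj, Pi.zero_apply, mul_zero, add_zero]
      exact hyA' j hj
    · have hj : A.mulVec r j < 0 := hj
      have h1 : τ j ≤ t := Finset.single_le_sum (fun j _ => hτ j) (Finset.mem_univ j)
      have h2 : τ j * A.mulVec r j = -|A.mulVec y j - b j| := by
        simp only [τ, abs_of_neg hj]
        rw [div_neg, neg_mul, div_mul_cancel₀ _ hj.ne]
      nlinarith [le_abs_self (A.mulVec y j - b j)]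
  · rw [Matrix.mulVec_add, Matrix.mulVec_smul, hC, smul_zero, add_zero, hyC']

/-- A polytope whose dimension `d` is positive has extension complexity at least `d + 1`; if the
extension complexity is `d + 1` or `d + 2`, it bounds the number of facets or of vertices. -/
theorem xc_dichotomy {p d : ℕ} {P : Set (Fin p → ℝ)} (hpoly : IsPolytope P)
    (hd : Module.finrank ℝ (affineSpan ℝ P).direction = d) (hd1 : 1 ≤ d) :
    d + 1 ≤ xc P ∧ (xc P ≤ d + 2 → numFacets P ≤ xc P ∨ numVertices P ≤ xc P) ∧
      (xc P = d + 1 → numVertices P ≤ xc P) := by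
  have hne : P.Nonempty := by
    rw [Set.nonempty_iff_ne_empty]
    rintro rfl
    rw [direction_affineSpan, vectorSpan_empty, finrank_bot] at hd
    omega
  obtain ⟨m₀, hm₀⟩ := exists_facetDescription hpoly
  have hex : IsExtFormulation P (xc P) :=
    Nat.sInf_mem (s := {m | IsExtFormulation P m})
      ⟨m₀, by simpa using isExtFormulation_of_facetDescription hm₀ LinearMap.id⟩
  obtain ⟨q, s, A, b, C, e, π, hP⟩ := hex
  obtain ⟨y₀, hy₀A, hy₀C⟩ : {y | A.mulVec y ≤ b ∧ C.mulVec y = e}.Nonempty := by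
    rw [← Set.image_nonempty, hP]
    exact hne
  let K := LinearMap.ker C.mulVecLin
  have hK : ∀ r ∈ K, A.mulVecLin r ≤ 0 → A.mulVecLin r = 0 ∧ π r = 0 := fun r hr hA =>
    recession_eq_zero_of_minimal hpoly.isCompact.isBounded hP hne (fun n hn => xc_le hn) hr hA
  have hP' : π '' {y | A.mulVecLin y ≤ b ∧ y - y₀ ∈ K} = P := by
    refine Eq.trans (congrArg _ ?_) hP
    ext y
    simp [K, Matrix.mulVec_sub, hy₀C, sub_eq_zero]
  have hle := finrank_direction_le hK hP'
  have hm : 0 < xc P := by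
    by_contra! h
    have h1 := (K.map A.mulVecLin).finrank_le
    rw [Module.finrank_fin_fun] at h1
    omega
  have hlt := finrank_map_lt hK hm
  have hv := numVertices_le_of_finrank_map hK hP' hy₀A
  have hf := facetDescription_of_finrank_map_le hK hP'
  refine ⟨by omega, fun h => ?_, fun h => hv (by omega)⟩
  by_cases hcase : Module.finrank ℝ (K.map A.mulVecLin) ≤ d
  · exact Or.inl (numFacets_le (hf (hd ▸ hcase)))
  · exact Or.inr (hv (by omega))

/-- A polytope whose affine hull has dimension `d ≥ 1`
satisfies `xc(P) = d + 2` iff `min{f(P), v(P)} = d + 2`. -/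
theorem stmt11 {p d : ℕ} (P : Set (Fin p → ℝ)) (hpoly : IsPolytope P)
    (hd : Module.finrank ℝ (affineSpan ℝ P).direction = d) (hd1 : 1 ≤ d) :
    xc P = d + 2 ↔ min (numFacets P) (numVertices P) = d + 2 := by
  obtain ⟨h1, h2, h3⟩ := xc_dichotomy hpoly hd hd1
  have hv := hpoly.xc_le_numVertices
  have hf : xc P ≤ numFacets P :=
    xc_le_of_facetDescription
      (Nat.sInf_mem (s := {m | HasFacetDescription P m}) (exists_facetDescription hpoly))
  omega
end

section
/- Let S ∈ ℝ^{m×n} be an entrywise nonnegative matrix and suppose S = R_1 + ⋯ + R_k where each R_ℓ ∈ ℝ^{m×n} is entrywise nonnegative of rank at most 1. Then for all indices i_1, i_2 ∈ {1,…,m} and j_1, j_2 ∈ {1,…,n} with S_{i_1,j_1}·S_{i_2,j_2} > S_{i_1,j_2}·S_{i_2,j_1}, there are at least two indices ℓ ∈ {1,…,k} such that R_ℓ is nonzero at (i_1,j_1) or at (i_2,j_2); that is, |{ℓ : supp(R_ℓ) ∩ {(i_1,j_1),(i_2,j_2)} ≠ ∅}| ≥ 2. -/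
theorem Matrix.mul_apply_eq_mul_apply_of_rank_le_one {m n K : Type*} [Fintype n] [Finite m]
    [Field K] {A : Matrix m n K} (hA : A.rank ≤ 1) (i₁ i₂ : m) (j₁ j₂ : n) :
    A i₁ j₁ * A i₂ j₂ = A i₁ j₂ * A i₂ j₁ := by
  classical
  obtain ⟨v, hv⟩ := finrank_le_one_iff.mp hA
  have hcol (j : n) : ∃ c : K, ∀ i, A i j = c * v.1 i := by
    obtain ⟨c, hc⟩ := hv ⟨A.mulVecLin (Pi.single j 1), LinearMap.mem_range_self _ _⟩
    refine ⟨c, fun i => ?_⟩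
    simpa using (congrFun (congrArg Subtype.val hc) i).symm
  obtain ⟨c, hc⟩ := hcol j₁
  obtain ⟨d, hd⟩ := hcol j₂
  rw [hc, hd, hd, hc]
  ring

/-- If a nonnegative matrix `S` is the sum of nonnegative
matrices `R₁, …, R_k` of rank at most 1, then for all indices with
`S_{i₁,j₁}·S_{i₂,j₂} > S_{i₁,j₂}·S_{i₂,j₁}` there are at least two indices `ℓ`
such that `R_ℓ` is nonzero at `(i₁,j₁)` or at `(i₂,j₂)`. -/
theorem stmt12 {m n k : ℕ} (S : Matrix (Fin m) (Fin n) ℝ)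
    (hS : ∀ i j, 0 ≤ S i j)
    (R : Fin k → Matrix (Fin m) (Fin n) ℝ)
    (hRnn : ∀ ℓ, ∀ i j, 0 ≤ R ℓ i j)
    (hRrk : ∀ ℓ, (R ℓ).rank ≤ 1)
    (hsum : S = ∑ ℓ, R ℓ)
    (i₁ i₂ : Fin m) (j₁ j₂ : Fin n)
    (hdet : S i₁ j₂ * S i₂ j₁ < S i₁ j₁ * S i₂ j₂) :
    2 ≤ Nat.card {ℓ : Fin k // R ℓ i₁ j₁ ≠ 0 ∨ R ℓ i₂ j₂ ≠ 0} := by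
  have hSum (i : Fin m) (j : Fin n) : S i j = ∑ ℓ, R ℓ i j := by
    rw [hsum, Matrix.sum_apply]
  have hle (ℓ : Fin k) (i : Fin m) (j : Fin n) : R ℓ i j ≤ S i j := by
    rw [hSum]
    exact Finset.single_le_sum (f := fun ℓ => R ℓ i j) (fun ℓ _ => hRnn ℓ i j)
      (Finset.mem_univ ℓ)
  by_contra! hcard
  have hsub := Finite.card_le_one_iff_subsingleton.mp (Nat.le_of_lt_succ hcard)
  have hS₁ : S i₁ j₁ ≠ 0 := by
    intro h
    rw [h, zero_mul] at hdet
    exact hdet.not_ge (mul_nonneg (hS _ _) (hS _ _))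
  obtain ⟨ℓ, -, hℓ⟩ := Finset.exists_ne_zero_of_sum_ne_zero (hSum i₁ j₁ ▸ hS₁)
  have hzero (b : Fin k) (hb : b ≠ ℓ) : R b i₁ j₁ = 0 ∧ R b i₂ j₂ = 0 := by
    by_contra h
    exact hb (congrArg Subtype.val
      (hsub.elim ⟨b, not_and_or.mp h⟩ ⟨ℓ, Or.inl hℓ⟩))
  have h₁ : S i₁ j₁ = R ℓ i₁ j₁ := by
    rw [hSum]
    exact Fintype.sum_eq_single ℓ fun b hb => (hzero b hb).1
  have h₂ : S i₂ j₂ = R ℓ i₂ j₂ := by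
    rw [hSum]
    exact Fintype.sum_eq_single ℓ fun b hb => (hzero b hb).2
  rw [h₁, h₂, Matrix.mul_apply_eq_mul_apply_of_rank_le_one (hRrk ℓ)] at hdet
  exact hdet.not_ge (mul_le_mul (hle _ _ _) (hle _ _ _) (hRnn _ _ _) (hS _ _))
end

section
/- Let P' ⊆ ℝ^p be a nonempty polytope, a ∈ ℝ^p \ {0} and β ∈ ℝ with P' ⊆ H^≤(a,β) = {x : ⟨a,x⟩ ≤ β}, and let φ_H(x) = x + 2·((β − ⟨a,x⟩)/‖a‖²)·a be the reflection through H = {x : ⟨a,x⟩ = β}. Then conv(P' ∪ φ_H(P')) = { x + λ·(2/‖a‖²)·a : x ∈ P', λ ∈ ℝ, 0 ≤ λ ≤ β − ⟨a,x⟩ }. -/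
/-- For a nonempty polytope `P' ⊆ {x : ⟨a,x⟩ ≤ β}` and the
reflection `φ_H` through the hyperplane `⟨a,x⟩ = β`,
`conv(P' ∪ φ_H(P')) = {x + λ·(2/‖a‖²)·a : x ∈ P', 0 ≤ λ ≤ β − ⟨a,x⟩}`. -/
theorem stmt15 {p : ℕ} (P' : Set (Fin p → ℝ)) (hpoly : IsPolytope P') (hne : P'.Nonempty)
    (a : Fin p → ℝ) (ha : a ≠ 0) (β : ℝ)
    (hsub : ∀ x ∈ P', (∑ i, a i * x i) ≤ β)
    (φ : (Fin p → ℝ) → (Fin p → ℝ))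
    (hφ : ∀ x, φ x = x + (2 * (β - ∑ i, a i * x i) / (∑ i, a i ^ 2)) • a) :
    convexHull ℝ (P' ∪ φ '' P') =
      {z | ∃ x ∈ P', ∃ lam : ℝ, 0 ≤ lam ∧ lam ≤ β - ∑ i, a i * x i ∧
        z = x + (lam * (2 / ∑ i, a i ^ 2)) • a} := by
  have hconv : Convex ℝ P' := by
    obtain ⟨V, rfl⟩ := hpoly
    exact convex_convexHull ℝ _
  apply Set.Subset.antisymm
  · refine convexHull_min ?_ ?_
    · rintro z (hz | ⟨x, hx, rfl⟩)
      · exact ⟨z, hz, 0, le_rfl, sub_nonneg.2 (hsub z hz), by simp⟩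
      · refine ⟨x, hx, β - ∑ i, a i * x i, sub_nonneg.2 (hsub x hx), le_rfl, ?_⟩
        rw [hφ]
        congr 2
        ring
    · rintro _ ⟨x, hx, l, hl0, hl, rfl⟩ _ ⟨y, hy, m, hm0, hm, rfl⟩ s t hs ht hst
      refine ⟨s • x + t • y, hconv hx hy hs ht hst, s * l + t * m, by positivity, ?_, ?_⟩
      · have hsum : ∑ i, a i * (s • x + t • y) i =
            s * ∑ i, a i * x i + t * ∑ i, a i * y i := by
          simp only [Pi.add_apply, Pi.smul_apply, smul_eq_mul, Finset.mul_sum,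
            ← Finset.sum_add_distrib]
          exact Finset.sum_congr rfl fun i _ => by ring
        rw [hsum]
        have hβ : β = s * β + t * β := by rw [← add_mul, hst, one_mul]
        linarith [mul_le_mul_of_nonneg_left hl hs, mul_le_mul_of_nonneg_left hm ht]
      · module
  · rintro _ ⟨x, hx, l, hl0, hl, rfl⟩
    have hxmem := subset_convexHull ℝ (P' ∪ φ '' P') (Or.inl hx)
    have hφmem := subset_convexHull ℝ (P' ∪ φ '' P') (Or.inr ⟨x, hx, rfl⟩)
    rcases (hl0.trans hl).eq_or_lt with h | h
    · obtain rfl : l = 0 := le_antisymm (h ▸ hl) hl0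
      simpa using hxmem
    · have ht1 : l / (β - ∑ i, a i * x i) ≤ 1 := (div_le_one h).2 hl
      convert convex_convexHull ℝ (P' ∪ φ '' P') hxmem hφmem (sub_nonneg.2 ht1)
        (div_nonneg hl0 h.le) (sub_add_cancel _ _) using 1
      have hcoef : l * (2 / ∑ i, a i ^ 2) = l / (β - ∑ i, a i * x i) *
          (2 * (β - ∑ i, a i * x i) / ∑ i, a i ^ 2) := by
        rw [mul_div_assoc', mul_div_assoc', mul_left_comm, div_mul_cancel₀ _ h.ne', mul_comm 2 l]
      rw [hφ, hcoef]
      module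
end

section
/- Let P' ⊆ ℝ^p be a nonempty polytope all of whose points have nonnegative coordinates, and let j ∈ {1,…,p}. Then conv(P' ∪ down_j(P')) = { z ∈ ℝ^p : there exists x ∈ P' with 0 ≤ z_j ≤ x_j and z_i = x_i for all i ≠ j }. -/
/-- For a nonempty polytope `P' ⊆ ℝ^p₊` and `j`,
`conv(P' ∪ down_j(P')) = {z : ∃ x ∈ P', 0 ≤ z_j ≤ x_j and z_i = x_i for i ≠ j}`. -/
theorem stmt16 {p : ℕ} (P' : Set (Fin p → ℝ)) (hpoly : IsPolytope P') (hne : P'.Nonempty)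
    (hnn : ∀ x ∈ P', ∀ i, 0 ≤ x i) (j : Fin p) :
    convexHull ℝ (P' ∪ (fun x : Fin p → ℝ => Function.update x j 0) '' P') =
      {z | ∃ x ∈ P', 0 ≤ z j ∧ z j ≤ x j ∧ ∀ i, i ≠ j → z i = x i} := by
  have hconv : Convex ℝ P' := by
    obtain ⟨V, rfl⟩ := hpoly
    exact convex_convexHull ℝ _
  apply Set.Subset.antisymm
  · apply convexHull_min
    · rintro z (hz | ⟨x, hx, rfl⟩)
      · exact ⟨z, hz, hnn z hz j, le_rfl, fun _ _ => rfl⟩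
      · exact ⟨x, hx, by simp, by simpa using hnn x hx j,
          fun i hi => Function.update_of_ne hi _ _⟩
    · rintro z ⟨x, hx, hz0, hzx, hz⟩ w ⟨y, hy, hw0, hwy, hw⟩ a b ha hb hab
      refine ⟨a • x + b • y, hconv hx hy ha hb hab, ?_, ?_, fun i hi => ?_⟩
      · simp only [Pi.add_apply, Pi.smul_apply, smul_eq_mul]
        positivity
      · simp only [Pi.add_apply, Pi.smul_apply, smul_eq_mul]
        gcongr
      · simp only [Pi.add_apply, Pi.smul_apply, hz i hi, hw i hi]
  · rintro z ⟨x, hx, hz0, hzx, hz⟩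
    have hmem : x ∈ convexHull ℝ (P' ∪ (fun x : Fin p → ℝ => Function.update x j 0) '' P') :=
      subset_convexHull ℝ _ (Or.inl hx)
    have hmem' : Function.update x j 0 ∈
        convexHull ℝ (P' ∪ (fun x : Fin p → ℝ => Function.update x j 0) '' P') :=
      subset_convexHull ℝ _ (Or.inr ⟨x, hx, rfl⟩)
    have hxj : 0 ≤ x j := hz0.trans hzx
    have hcomb := convex_convexHull ℝ _ hmem hmem' (div_nonneg hz0 hxj)
      (sub_nonneg.2 (div_le_one_of_le₀ hzx hxj)) (add_sub_cancel _ _)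
    convert hcomb using 1
    ext i
    rcases eq_or_ne i j with rfl | hi
    · rcases hxj.eq_or_lt with h | h
      · simp [← h, le_antisymm (hzx.trans h.ge) hz0]
      · simp [h.ne']
    · simp only [Pi.add_apply, Pi.smul_apply, smul_eq_mul, Function.update_of_ne hi, hz i hi]
      ring
end

section
/- Let V ⊆ ℝ^q be a finite nonempty set, C ⊆ ℝ^q a convex cone containing 0, and Q = conv(V) + C. Let π : ℝ^q → ℝ^p be a linear map with C contained in the kernel of π, let c ∈ C with c ≠ 0, set γ = max{⟨c,v⟩ : v ∈ conv(V)}, and let Q' = {y ∈ Q : ⟨c,y⟩ = γ}. Then π(Q') = π(Q). -/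
open scoped Pointwise

/-- Let `Q = conv(V) + C` with `V` finite nonempty and `C` a
convex cone containing `0` lying in the kernel of the linear map `π`. For
`c ∈ C \ {0}` and `γ = max{⟨c,v⟩ : v ∈ conv(V)}`, the slice
`Q' = {y ∈ Q : ⟨c,y⟩ = γ}` satisfies `π(Q') = π(Q)`. -/
theorem stmt18 {q p : ℕ} (V : Finset (Fin q → ℝ)) (hVne : V.Nonempty)
    (C : Set (Fin q → ℝ))
    (hC0 : (0 : Fin q → ℝ) ∈ C)
    (hCsmul : ∀ w ∈ C, ∀ t : ℝ, 0 ≤ t → t • w ∈ C)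
    (hCadd : ∀ w₁ ∈ C, ∀ w₂ ∈ C, w₁ + w₂ ∈ C)
    (Q : Set (Fin q → ℝ)) (hQ : Q = convexHull ℝ (V : Set (Fin q → ℝ)) + C)
    (π : (Fin q → ℝ) →ₗ[ℝ] (Fin p → ℝ))
    (hker : ∀ w ∈ C, π w = 0)
    (c : Fin q → ℝ) (hcC : c ∈ C) (hc0 : c ≠ 0)
    (γ : ℝ)
    (hγ : IsGreatest ((fun v : Fin q → ℝ => ∑ i, c i * v i) ''
      convexHull ℝ (V : Set (Fin q → ℝ))) γ)
    (Q' : Set (Fin q → ℝ)) (hQ' : Q' = {y ∈ Q | (∑ i, c i * y i) = γ}) :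
    π '' Q' = π '' Q := by
  subst hQ hQ'
  refine (Set.image_mono fun y hy => hy.1).antisymm ?_
  rintro _ ⟨_, ⟨v, hv, w, hw, rfl⟩, rfl⟩
  have hcc : 0 < ∑ i, c i * c i := by
    obtain ⟨i, hi⟩ := Function.ne_iff.mp hc0
    exact Finset.sum_pos' (fun j _ => mul_self_nonneg (c j))
      ⟨i, Finset.mem_univ i, mul_self_pos.mpr hi⟩
  have hle : ∑ i, c i * v i ≤ γ := hγ.2 ⟨v, hv, rfl⟩
  set t : ℝ := (γ - ∑ i, c i * v i) / ∑ i, c i * c i with ht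
  have htc : t • c ∈ C := hCsmul c hcC t (div_nonneg (sub_nonneg.mpr hle) hcc.le)
  refine ⟨v + t • c, ⟨Set.add_mem_add hv htc, ?_⟩, ?_⟩
  · have hsum : ∑ i, c i * (v + t • c) i = ∑ i, c i * v i + t * ∑ i, c i * c i := by
      rw [Finset.mul_sum, ← Finset.sum_add_distrib]
      refine Finset.sum_congr rfl fun i _ => ?_
      simp only [Pi.add_apply, Pi.smul_apply, smul_eq_mul]
      ring
    rw [hsum, ht, div_mul_cancel₀ _ hcc.ne']
    ring
  · simp only [map_add, hker _ htc, hker _ hw]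
end
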